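/- Define g : ℝ → ℝ by g(x) = x/|x|^{1/2} for x ≠ 0 and g(0) = 0. There exists a function Y : [0,∞)×[−1,1] → ℝ, Lipschitz on [0,∞)×[−1,1], such that: for every t ≥ 0 and α ∈ [−1,1], Y(t,α) = α − ∫₀ᵗ ∫_{−1}^{1} g(Y(s,α) − Y(s,β)) dβ ds; for each t the map α ↦ Y(t,α) is odd and nondecreasing; for each α the map t ↦ |Y(t,α)| is nonincreasing; and Y(t,α) = 0 for every α ∈ [−1,1] and every t ≥ 2. -/

import Mathlib

open MeasureTheory Set

noncomputable section

/-- The function `g(x) = x / |x|^(1/2)` for `x ≠ 0`, `g(0) = 0`. -/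
def gFun (x : ℝ) : ℝ := if x = 0 then 0 else x / |x| ^ ((1 : ℝ)/2)

open Filter Topology

/-- A regularization of `gFun`, which is the case `δ = 0`. -/
def rootDiff (δ x : ℝ) : ℝ := √(max x 0 + δ ^ 2) - √(max (-x) 0 + δ ^ 2)

lemma rootDiff_neg (δ x : ℝ) : rootDiff δ (-x) = -rootDiff δ x := by
  simp [rootDiff]

lemma rootDiff_zero_right (δ : ℝ) : rootDiff δ 0 = 0 := by
  simp [rootDiff]

lemma continuous_rootDiff : Continuous (fun p : ℝ × ℝ => rootDiff p.1 p.2) := by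
  unfold rootDiff
  fun_prop

lemma rootDiff_of_nonneg {x : ℝ} (hx : 0 ≤ x) : rootDiff 0 x = √x := by
  simp [rootDiff, hx]

lemma gFun_eq_rootDiff (x : ℝ) : gFun x = rootDiff 0 x := by
  have key (y : ℝ) (hy : 0 < y) : y / √y = √y := by
    rw [Real.div_sqrt]
  unfold gFun
  split_ifs with h
  · rw [h, rootDiff_zero_right]
  · rw [← Real.sqrt_eq_rpow]
    rcases lt_or_gt_of_ne h with h | h
    · have := rootDiff_neg 0 x
      rw [rootDiff_of_nonneg (by linarith)] at this
      have hk := key (-x) (by linarith)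
      rw [neg_div] at hk
      rw [abs_of_neg h]
      linarith
    · rw [abs_of_pos h, key x h, rootDiff_of_nonneg h.le]

lemma monotone_rootDiff (δ : ℝ) : Monotone (rootDiff δ) := by
  intro x y h
  unfold rootDiff
  gcongr

lemma sqrt_sub_sqrt_le_sqrt_abs_sub {a b : ℝ} (hb : 0 ≤ b) :
    √a - √b ≤ √|a - b| := by
  have : √a ≤ √|a - b| + √b := by
    refine Real.sqrt_le_iff.mpr ⟨by positivity, ?_⟩
    have h1 := Real.sq_sqrt (abs_nonneg (a - b))
    have h2 := Real.sq_sqrt hb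
    have h3 : 0 ≤ √|a - b| * √b := by positivity
    nlinarith [le_abs_self (a - b)]
  linarith

lemma abs_rootDiff_sub_le (δ x y : ℝ) : |rootDiff δ x - rootDiff δ y| ≤ 2 * √|x - y| := by
  have key (x y : ℝ) : √(max x 0 + δ ^ 2) - √(max y 0 + δ ^ 2) ≤ √|x - y| := by
    refine (sqrt_sub_sqrt_le_sqrt_abs_sub
      (add_nonneg (le_max_right y 0) (sq_nonneg δ))).trans ?_
    apply Real.sqrt_le_sqrt
    rw [add_sub_add_right_eq_sub]
    exact abs_max_sub_max_le_abs x y 0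
  have h1 := key x y
  have h2 := key y x
  have h3 := key (-x) (-y)
  have h4 := key (-y) (-x)
  rw [abs_sub_comm y x] at h2
  rw [neg_sub_neg, abs_sub_comm y x] at h3
  rw [neg_sub_neg] at h4
  unfold rootDiff
  rw [abs_le]
  constructor <;> linarith

lemma abs_rootDiff_le {δ x : ℝ} (hx : |x| ≤ 2) : |rootDiff δ x| ≤ 3 := by
  have h := abs_rootDiff_sub_le δ x 0
  rw [rootDiff_zero_right, sub_zero, sub_zero] at h
  have : √|x| ≤ 3 / 2 := Real.sqrt_le_iff.mpr ⟨by norm_num, by linarith⟩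
  linarith

lemma rootDiff_sub_le {δ x y : ℝ} (hδ : 0 < δ) (h : x ≤ y) :
    rootDiff δ y - rootDiff δ x ≤ (y - x) / (2 * δ) := by
  have key {a b : ℝ} (hb : 0 ≤ b) (hab : b ≤ a) :
      √(a + δ ^ 2) - √(b + δ ^ 2) ≤ (a - b) / (2 * δ) := by
    have h1 : δ ≤ √(b + δ ^ 2) := Real.le_sqrt_of_sq_le (by linarith)
    have h2 : √(b + δ ^ 2) ≤ √(a + δ ^ 2) := Real.sqrt_le_sqrt (by linarith)
    have h3 := Real.sq_sqrt (show 0 ≤ a + δ ^ 2 by linarith [sq_nonneg δ])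
    have h4 := Real.sq_sqrt (show 0 ≤ b + δ ^ 2 by positivity)
    rw [le_div_iff₀ (by positivity)]
    nlinarith
  have h1 := key (le_max_right x 0) (max_le_max_right 0 h)
  have h2 := key (le_max_right (-y) 0) (max_le_max_right 0 (neg_le_neg h))
  have h3 (z : ℝ) : max z 0 - max (-z) 0 = z := max_zero_sub_max_neg_zero_eq_self z
  have h4 : (y - x) / (2 * δ) =
      (max y 0 - max x 0) / (2 * δ) + (max (-x) 0 - max (-y) 0) / (2 * δ) := by
    rw [← add_div]
    congr 1
    linarith [h3 x, h3 y]
  unfold rootDiff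
  linarith

/-- Odd, nondecreasing, `1`-Lipschitz functions with values in `[-1, 1]`. -/
structure IsProfile (u : ℝ → ℝ) : Prop where
  odd : ∀ a, u (-a) = -u a
  mono : Monotone u
  lip : ∀ a b, |u a - u b| ≤ |a - b|
  bound : ∀ a, |u a| ≤ 1

/-- The regularized attraction felt at position `y` by the configuration `u`. -/
def drift (δ : ℝ) (u : ℝ → ℝ) (y : ℝ) : ℝ := ∫ β in (-1 : ℝ)..1, rootDiff δ (y - u β)

lemma continuous_rootDiff_right (δ : ℝ) : Continuous (rootDiff δ) :=
  continuous_rootDiff.comp (Continuous.prodMk_right δ)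

lemma abs_integral_le_two_mul {f : ℝ → ℝ} {C : ℝ} (h : ∀ β, |f β| ≤ C) :
    |∫ β in (-1 : ℝ)..1, f β| ≤ 2 * C := by
  have := intervalIntegral.norm_integral_le_of_norm_le_const (a := -1) (b := 1) (f := f) (C := C)
    (fun β _ => h β)
  rw [Real.norm_eq_abs] at this
  norm_num at this
  linarith

namespace IsProfile

variable {u v : ℝ → ℝ}

lemma continuous (hu : IsProfile u) : Continuous u :=
  (LipschitzWith.mk_one fun a b => by simpa [Real.dist_eq] using hu.lip a b).continuous

lemma map_zero (hu : IsProfile u) : u 0 = 0 := by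
  have := hu.odd 0
  rw [neg_zero] at this
  linarith

lemma abs_sub_le (hu : IsProfile u) {y : ℝ} (hy : |y| ≤ 1) (b : ℝ) : |y - u b| ≤ 2 := by
  linarith [abs_sub y (u b), hu.bound b]

lemma intervalIntegrable (hu : IsProfile u) (δ y : ℝ) :
    IntervalIntegrable (fun β => rootDiff δ (y - u β)) volume (-1) 1 :=
  ((continuous_rootDiff_right δ).comp (continuous_const.sub hu.continuous)).intervalIntegrable _ _

lemma drift_neg (hu : IsProfile u) (δ y : ℝ) : drift δ u (-y) = -drift δ u y := by
  have h := intervalIntegral.integral_comp_neg (a := -1) (b := 1)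
    (fun β => rootDiff δ (-y - u β))
  rw [neg_neg] at h
  unfold drift
  rw [← h, ← intervalIntegral.integral_neg]
  congr 1
  ext β
  rw [hu.odd, ← rootDiff_neg]
  congr 1
  ring

lemma drift_zero (hu : IsProfile u) (δ : ℝ) : drift δ u 0 = 0 := by
  have := hu.drift_neg δ 0
  rw [neg_zero] at this
  linarith

lemma drift_mono (hu : IsProfile u) (δ : ℝ) : Monotone (drift δ u) := by
  intro y z h
  exact intervalIntegral.integral_mono_on (by norm_num) (hu.intervalIntegrable δ y)
    (hu.intervalIntegrable δ z) fun β _ => monotone_rootDiff δ (by linarith)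

lemma abs_drift_le (hu : IsProfile u) (δ : ℝ) {y : ℝ} (hy : |y| ≤ 1) : |drift δ u y| ≤ 6 := by
  have := abs_integral_le_two_mul fun β => abs_rootDiff_le (δ := δ) (hu.abs_sub_le hy β)
  unfold drift
  linarith

lemma abs_drift_sub_le (hu : IsProfile u) (hv : IsProfile v) (δ : ℝ) {y z r : ℝ}
    (hyz : |y - z| ≤ r) (huv : ∀ b, |u b - v b| ≤ r) :
    |drift δ u y - drift δ v z| ≤ 4 * √(2 * r) := by
  unfold drift
  rw [← intervalIntegral.integral_sub (hu.intervalIntegrable δ y) (hv.intervalIntegrable δ z)]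
  refine (abs_integral_le_two_mul (C := 2 * √(2 * r)) fun β => ?_).trans (by linarith)
  refine (abs_rootDiff_sub_le _ _ _).trans ?_
  gcongr
  have := abs_sub (y - z) (u β - v β)
  rw [show y - u β - (z - v β) = y - z - (u β - v β) by ring]
  linarith [huv β]

lemma drift_sub_le (hu : IsProfile u) {δ y z : ℝ} (hδ : 0 < δ) (h : y ≤ z) :
    δ * (drift δ u z - drift δ u y) ≤ z - y := by
  have h1 : drift δ u z - drift δ u y ≤ ∫ _ in (-1 : ℝ)..1, (z - y) / (2 * δ) := by
    unfold drift
    rw [← intervalIntegral.integral_sub (hu.intervalIntegrable δ z) (hu.intervalIntegrable δ y)]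
    refine intervalIntegral.integral_mono_on (by norm_num)
      ((hu.intervalIntegrable δ z).sub (hu.intervalIntegrable δ y)) (by simp) fun β _ => ?_
    exact (rootDiff_sub_le hδ (by linarith : y - u β ≤ z - u β)).trans_eq (by ring)
  rw [intervalIntegral.integral_const, smul_eq_mul] at h1
  calc δ * (drift δ u z - drift δ u y) ≤ δ * ((1 - -1) * ((z - y) / (2 * δ))) := by gcongr
    _ = z - y := by field_simp; ring

end IsProfile

/-- One explicit Euler step of length `δ`. -/
def eulerStep (δ : ℝ) (u : ℝ → ℝ) (a : ℝ) : ℝ := u a - δ * drift δ u (u a)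

lemma IsProfile.abs_eulerStep_le {u : ℝ → ℝ} (hu : IsProfile u) {δ : ℝ} (hδ : 0 < δ) (a : ℝ) :
    |eulerStep δ u a| ≤ |u a| := by
  unfold eulerStep
  rcases le_total 0 (u a) with h | h
  · have h1 := hu.drift_sub_le hδ h
    have h2 := hu.drift_mono δ h
    rw [hu.drift_zero] at h1 h2
    have h3 := mul_nonneg hδ.le h2
    rw [abs_of_nonneg h, abs_of_nonneg] <;> linarith
  · have h1 := hu.drift_sub_le hδ h
    have h2 := hu.drift_mono δ h
    rw [hu.drift_zero] at h1 h2
    have h3 := mul_nonneg_of_nonpos_of_nonpos (neg_nonpos.mpr hδ.le) h2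
    rw [abs_of_nonpos h, abs_of_nonpos] <;> linarith

lemma IsProfile.eulerStep {u : ℝ → ℝ} (hu : IsProfile u) {δ : ℝ} (hδ : 0 < δ) :
    IsProfile (eulerStep δ u) := by
  have key {a b : ℝ} (h : a ≤ b) :
      0 ≤ _root_.eulerStep δ u b - _root_.eulerStep δ u a ∧
        _root_.eulerStep δ u b - _root_.eulerStep δ u a ≤ b - a := by
    have h0 := hu.mono h
    have h1 := hu.drift_sub_le hδ h0
    have h2 := mul_nonneg hδ.le (sub_nonneg.mpr (hu.drift_mono δ h0))
    have h3 := hu.lip b a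
    rw [abs_of_nonneg (by linarith), abs_of_nonneg (by linarith)] at h3
    unfold _root_.eulerStep
    constructor <;> linarith
  refine ⟨fun a => ?_, fun a b h => by linarith [(key h).1], fun a b => ?_, fun a =>
    (hu.abs_eulerStep_le hδ a).trans (hu.bound a)⟩
  · unfold _root_.eulerStep
    rw [hu.odd, hu.drift_neg]
    ring
  · rcases le_total a b with h | h
    · obtain ⟨h1, h2⟩ := key h
      rw [abs_sub_comm, abs_sub_comm a b, abs_of_nonneg h1, abs_of_nonneg (by linarith)]
      exact h2
    · obtain ⟨h1, h2⟩ := key h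
      rw [abs_of_nonneg h1, abs_of_nonneg (by linarith)]
      exact h2

/-- The explicit Euler scheme with step `δ`, started from the projection onto `[-1, 1]`. -/
def eulerIter (δ : ℝ) : ℕ → ℝ → ℝ
  | 0 => fun a => max (-1) (min a 1)
  | k + 1 => eulerStep δ (eulerIter δ k)

lemma isProfile_clamp : IsProfile fun a => max (-1) (min a 1) := by
  refine ⟨fun a => ?_, fun a b h => ?_, fun a b => ?_, fun a => ?_⟩
  · grind
  · gcongr
  · grind
  · grind

lemma isProfile_eulerIter {δ : ℝ} (hδ : 0 < δ) (k : ℕ) : IsProfile (eulerIter δ k) := by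
  induction k with
  | zero => exact isProfile_clamp
  | succ k ih => exact ih.eulerStep hδ

lemma antitone_abs_eulerIter {δ : ℝ} (hδ : 0 < δ) (a : ℝ) : Antitone fun k => |eulerIter δ k a| :=
  antitone_nat_of_succ_le fun k => (isProfile_eulerIter hδ k).abs_eulerStep_le hδ a

lemma abs_eulerIter_add_sub_le {δ : ℝ} (hδ : 0 < δ) (k m : ℕ) (a : ℝ) :
    |eulerIter δ (k + m) a - eulerIter δ k a| ≤ 6 * (m * δ) := by
  induction m with
  | zero => simp
  | succ m ih =>
    have hp := isProfile_eulerIter hδ (k + m)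
    have h := hp.abs_drift_le δ (hp.bound a)
    have h1 : eulerIter δ (k + (m + 1)) a =
      eulerIter δ (k + m) a - δ * drift δ (eulerIter δ (k + m)) (eulerIter δ (k + m) a) := rfl
    have h2 : |δ * drift δ (eulerIter δ (k + m)) (eulerIter δ (k + m) a)| ≤ δ * 6 := by
      rw [abs_mul, abs_of_pos hδ]
      gcongr
    rw [h1]
    push_cast
    rw [abs_le] at *
    constructor <;> linarith

lemma abs_eulerIter_sub_le {δ : ℝ} (hδ : 0 < δ) (k j : ℕ) (a : ℝ) :
    |eulerIter δ k a - eulerIter δ j a| ≤ 6 * (|(k : ℝ) - j| * δ) := by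
  rcases le_total j k with h | h
  · obtain ⟨m, rfl⟩ := Nat.exists_eq_add_of_le h
    simpa using abs_eulerIter_add_sub_le hδ j m a
  · obtain ⟨m, rfl⟩ := Nat.exists_eq_add_of_le h
    rw [abs_sub_comm, abs_sub_comm (k : ℝ)]
    simpa using abs_eulerIter_add_sub_le hδ k m a

lemma abs_eulerIter_taylor_le {δ : ℝ} (hδ : 0 < δ) (k m M : ℕ) (hm : m ≤ M)
    (a : ℝ) :
    |eulerIter δ (k + m) a - eulerIter δ k a +
        m * δ * drift δ (eulerIter δ k) (eulerIter δ k a)| ≤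
      m * δ * (4 * √(2 * (6 * (M * δ)))) := by
  induction m with
  | zero => simp
  | succ m ih =>
    have ih := ih (by omega)
    have hM : (m : ℝ) ≤ M := by exact_mod_cast (show m ≤ M by omega)
    have hd (b : ℝ) : |eulerIter δ (k + m) b - eulerIter δ k b| ≤ 6 * (M * δ) :=
      (abs_eulerIter_add_sub_le hδ k m b).trans (by gcongr)
    have h := (isProfile_eulerIter hδ (k + m)).abs_drift_sub_le (isProfile_eulerIter hδ k) δ
      (hd a) hd
    have h1 : eulerIter δ (k + (m + 1)) a =
      eulerIter δ (k + m) a - δ * drift δ (eulerIter δ (k + m)) (eulerIter δ (k + m) a) := rfl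
    rw [h1]
    push_cast
    rw [abs_le] at *
    constructor <;> nlinarith

lemma exists_subseq_tendsto_of_almost_lipschitz {E : Type*} [PseudoMetricSpace E]
    [TopologicalSpace.SeparableSpace E] [Nonempty E] {X : ℕ → E → ℝ} {C : ℝ} {e : ℕ → ℝ}
    (hC : 0 ≤ C) (he : Tendsto e atTop (𝓝 0)) (hb : ∀ n p, |X n p| ≤ 1)
    (hX : ∀ n p q, |X n p - X n q| ≤ C * dist p q + e n) :
    ∃ φ : ℕ → ℕ, StrictMono φ ∧
      ∃ Y : E → ℝ, ∀ p, Tendsto (fun n => X (φ n) p) atTop (𝓝 (Y p)) := by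
  let d := TopologicalSpace.denseSeq E
  have hK : IsCompact (Set.pi univ fun _ : ℕ => Icc (-1 : ℝ) 1) :=
    isCompact_univ_pi fun _ => isCompact_Icc
  obtain ⟨L, -, φ, hφ, hlim⟩ := hK.tendsto_subseq (x := fun n i => X n (d i))
    fun n i _ => abs_le.mp (hb n _)
  rw [tendsto_pi_nhds] at hlim
  refine ⟨φ, hφ, ?_⟩
  have hconv (p : E) : ∃ y, Tendsto (fun n => X (φ n) p) atTop (𝓝 y) := by
    refine cauchySeq_tendsto_of_complete (Metric.cauchySeq_iff'.2 fun ε hε => ?_)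
    obtain ⟨_, hi, i, rfl⟩ := Metric.dense_iff.mp (TopologicalSpace.denseRange_denseSeq E) p
      (ε / (6 * (C + 1))) (by positivity)
    have hi' : C * dist p (d i) < ε / 6 := by
      rw [Metric.mem_ball, dist_comm, lt_div_iff₀ (by positivity)] at hi
      nlinarith [dist_nonneg (x := p) (y := d i)]
    have h1 : ∀ᶠ n in atTop, e (φ n) < ε / 6 :=
      (he.comp hφ.tendsto_atTop).eventually_lt_const (by positivity)
    have h2 : ∀ᶠ n in atTop, dist (X (φ n) (d i)) (L i) < ε / 6 :=
      (hlim i).eventually (Metric.ball_mem_nhds _ (by positivity))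
    obtain ⟨N, hN⟩ := eventually_atTop.mp (h1.and h2)
    refine ⟨N, fun n hn => ?_⟩
    obtain ⟨a1, a2⟩ := hN n hn
    obtain ⟨b1, b2⟩ := hN N le_rfl
    have a3 := hX (φ n) p (d i)
    have b3 := hX (φ N) p (d i)
    rw [Real.dist_eq] at *
    rw [abs_le] at a3 b3
    rw [abs_lt] at *
    constructor <;> linarith
  choose Y hY using hconv
  exact ⟨Y, hY⟩

lemma abs_floor_sub_floor_le (x y : ℝ) : |(⌊x⌋₊ : ℝ) - ⌊y⌋₊| ≤ |x - y| + 1 := by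
  wlog h : y ≤ x generalizing x y
  · rw [abs_sub_comm, abs_sub_comm x]
    exact this y x (by linarith)
  have h1 : (⌊y⌋₊ : ℝ) ≤ ⌊x⌋₊ := by exact_mod_cast Nat.floor_mono h
  rw [abs_of_nonneg (by linarith), abs_of_nonneg (by linarith)]
  have h2 := Nat.lt_floor_add_one y
  rcases le_total 0 x with hx | hx
  · linarith [Nat.floor_le hx]
  · rw [Nat.floor_of_nonpos hx, Nat.floor_of_nonpos (h.trans hx)]
    simp only [sub_self]
    linarith

lemma tendsto_drift {u : ℕ → ℝ → ℝ} {v : ℝ → ℝ} {δ : ℕ → ℝ} (hu : ∀ n, IsProfile (u n))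
    (hδ : Tendsto δ atTop (𝓝 0)) (huv : ∀ b, Tendsto (fun n => u n b) atTop (𝓝 (v b))) (a : ℝ) :
    Tendsto (fun n => drift (δ n) (u n) (u n a)) atTop (𝓝 (drift 0 v (v a))) := by
  refine intervalIntegral.tendsto_integral_filter_of_dominated_convergence (fun _ => 3)
    (.of_forall fun n => ?_) (.of_forall fun n => .of_forall fun b _ => ?_) (by simp)
    (.of_forall fun b _ => ?_)
  · exact ((continuous_rootDiff_right _).comp
      (continuous_const.sub (hu n).continuous)).aestronglyMeasurable
  · exact abs_rootDiff_le ((hu n).abs_sub_le ((hu n).bound a) b)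
  · exact (continuous_rootDiff.tendsto (0, v a - v b)).comp
      (hδ.prodMk_nhds ((huv a).sub (huv b)))

lemma isProfile_of_tendsto {u : ℕ → ℝ → ℝ} {v : ℝ → ℝ} (hu : ∀ n, IsProfile (u n))
    (huv : ∀ b, Tendsto (fun n => u n b) atTop (𝓝 (v b))) : IsProfile v where
  odd a := tendsto_nhds_unique (huv (-a)) (by simpa only [(hu _).odd] using (huv a).neg)
  mono a b h := le_of_tendsto_of_tendsto' (huv a) (huv b) fun n => (hu n).mono h
  lip a b := le_of_tendsto' ((huv a).sub (huv b)).abs fun n => (hu n).lip a b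
  bound a := le_of_tendsto' (huv a).abs fun n => (hu n).bound a

/-- The Euler scheme with step `1 / (n + 1)`, as a step function of time. -/
def eulerApprox (n : ℕ) (t : ℝ) : ℝ → ℝ := eulerIter (1 / (n + 1)) ⌊t * (n + 1)⌋₊

lemma isProfile_eulerApprox (n : ℕ) (t : ℝ) : IsProfile (eulerApprox n t) :=
  isProfile_eulerIter (by positivity) _

lemma abs_eulerApprox_sub_le (n : ℕ) (t s a b : ℝ) :
    |eulerApprox n t a - eulerApprox n s b| ≤ 6 * |t - s| + |a - b| + 6 * (1 / (n + 1)) := by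
  have hn : (0 : ℝ) < n + 1 := by positivity
  have h1 : |eulerApprox n t a - eulerApprox n s a| ≤ 6 * |t - s| + 6 * (1 / (n + 1)) := by
    refine (abs_eulerIter_sub_le (by positivity) _ _ a).trans ?_
    calc 6 * (|(⌊t * (n + 1)⌋₊ : ℝ) - ⌊s * (n + 1)⌋₊| * (1 / (n + 1)))
        ≤ 6 * ((|t * (n + 1) - s * (n + 1)| + 1) * (1 / (n + 1))) := by
          gcongr
          exact abs_floor_sub_floor_le _ _
      _ = 6 * |t - s| + 6 * (1 / (n + 1)) := by
          rw [← sub_mul, abs_mul, abs_of_pos hn]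
          field_simp
  have h2 := (isProfile_eulerApprox n s).lip a b
  linarith [abs_sub_le (eulerApprox n t a) (eulerApprox n s a) (eulerApprox n s b)]

lemma tendsto_floor_mul_one_div {t : ℝ} (ht : 0 ≤ t) :
    Tendsto (fun n : ℕ => (⌊t * (n + 1)⌋₊ : ℝ) * (1 / (n + 1))) atTop (𝓝 t) := by
  have h : Tendsto (fun n : ℕ => (n : ℝ) + 1) atTop atTop :=
    tendsto_atTop_add_const_right _ _ tendsto_natCast_atTop_atTop
  refine ((tendsto_nat_floor_mul_div_atTop ht).comp h).congr fun n => ?_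
  simp [div_eq_mul_inv]

/-- A limit of the Euler scheme; the last conjunct says that it moves with velocity
`-drift 0`. -/
lemma exists_limit_eulerApprox : ∃ Y : ℝ → ℝ → ℝ,
    (∀ t s a b, |Y t a - Y s b| ≤ 6 * |t - s| + |a - b|) ∧
    (∀ t, IsProfile (Y t)) ∧
    (∀ a, Antitone fun t => |Y t a|) ∧
    (∀ a ∈ Icc (-1 : ℝ) 1, Y 0 a = a) ∧
    ∀ s t a, 0 ≤ s → s ≤ t → |Y t a - Y s a + (t - s) * drift 0 (Y s) (Y s a)| ≤
      (t - s) * (4 * √(2 * (6 * (t - s)))) := by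
  have hδ : Tendsto (fun n : ℕ => 1 / ((n : ℝ) + 1)) atTop (𝓝 0) :=
    tendsto_one_div_add_atTop_nhds_zero_nat
  have hδ6 : Tendsto (fun n : ℕ => 6 * (1 / ((n : ℝ) + 1))) atTop (𝓝 0) := by
    simpa using hδ.const_mul 6
  obtain ⟨φ, hφ, Z, hZ⟩ := exists_subseq_tendsto_of_almost_lipschitz (E := ℝ × ℝ)
    (X := fun n p => eulerApprox n p.1 p.2) (C := 7) (by norm_num) hδ6
    (fun n p => (isProfile_eulerApprox n p.1).bound p.2) (fun n p q => by
      refine (abs_eulerApprox_sub_le n p.1 q.1 p.2 q.2).trans ?_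
      have h1 : |p.1 - q.1| ≤ dist p q := le_max_left _ _
      have h2 : |p.2 - q.2| ≤ dist p q := le_max_right _ _
      linarith)
  have hY (t a : ℝ) : Tendsto (fun n => eulerApprox (φ n) t a) atTop (𝓝 (Z (t, a))) := hZ (t, a)
  refine ⟨fun t a => Z (t, a), fun t s a b => ?_, fun t =>
    isProfile_of_tendsto (fun n => isProfile_eulerApprox (φ n) t) (hY t), fun a s t h => ?_,
    fun a ha => ?_, fun s t a hs hst => ?_⟩
  · refine le_of_tendsto_of_tendsto' ((hY t a).sub (hY s b)).abs ?_
      fun n => abs_eulerApprox_sub_le (φ n) t s a b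
    simpa using (hδ6.comp hφ.tendsto_atTop).const_add (6 * |t - s| + |a - b|)
  · refine le_of_tendsto_of_tendsto' (hY t a).abs (hY s a).abs fun n => ?_
    exact antitone_abs_eulerIter (by positivity) a (Nat.floor_mono (by gcongr))
  · refine tendsto_nhds_unique (hY 0 a) (tendsto_const_nhds.congr fun n => ?_)
    simp [eulerApprox, eulerIter, ha.1, ha.2]
  · have hm : Tendsto (fun n => ((⌊t * (φ n + 1)⌋₊ : ℝ) - ⌊s * (φ n + 1)⌋₊) * (1 / (φ n + 1)))
        atTop (𝓝 (t - s)) := by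
      simp only [sub_mul]
      exact ((tendsto_floor_mul_one_div (hs.trans hst)).sub
        (tendsto_floor_mul_one_div hs)).comp hφ.tendsto_atTop
    have hd := tendsto_drift (fun n => isProfile_eulerApprox (φ n) s)
      (hδ.comp hφ.tendsto_atTop) (hY s) a
    refine le_of_tendsto_of_tendsto' (((hY t a).sub (hY s a)).add (hm.mul hd)).abs
      (hm.mul ((((hm.const_mul 6).const_mul 2).sqrt).const_mul 4)) fun n => ?_
    have hfl : ⌊s * ((φ n : ℝ) + 1)⌋₊ ≤ ⌊t * ((φ n : ℝ) + 1)⌋₊ := Nat.floor_mono (by gcongr)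
    obtain ⟨m, hm⟩ := Nat.exists_eq_add_of_le hfl
    have h := abs_eulerIter_taylor_le (δ := 1 / ((φ n : ℝ) + 1)) (by positivity)
      ⌊s * ((φ n : ℝ) + 1)⌋₊ m m le_rfl a
    simp only [eulerApprox, hm, Nat.cast_add, add_sub_cancel_left]
    exact h

/-- A quantitative first-order expansion to the right determines the right derivative. -/
lemma hasDerivWithinAt_Ici_of_abs_sub_le {f : ℝ → ℝ} {s d : ℝ}
    (h : ∀ t, s ≤ t → |f t - f s + (t - s) * d| ≤ (t - s) * (4 * √(2 * (6 * (t - s))))) :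
    HasDerivWithinAt f (-d) (Ici s) s := by
  rw [hasDerivWithinAt_iff_isLittleO]
  have hlim : Tendsto (fun t => 4 * √(2 * (6 * (t - s)))) (𝓝[Ici s] s) (𝓝 0) := by
    have : Continuous fun t => 4 * √(2 * (6 * (t - s))) := by fun_prop
    simpa using (this.tendsto s).mono_left nhdsWithin_le_nhds
  rw [Asymptotics.isLittleO_iff]
  intro c hc
  filter_upwards [self_mem_nhdsWithin, hlim.eventually_lt_const hc] with t ht htc
  have hts : 0 ≤ t - s := sub_nonneg.mpr ht
  have := h t ht
  rw [Real.norm_eq_abs, Real.norm_eq_abs, abs_of_nonneg hts, smul_eq_mul]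
  rw [show f t - f s - (t - s) * -d = f t - f s + (t - s) * d by ring]
  nlinarith

lemma IsProfile.sqrt_le_drift {u : ℝ → ℝ} (hu : IsProfile u) : √(u 1) ≤ drift 0 u (u 1) := by
  have h0 : 0 ≤ u 1 := hu.map_zero.symm.le.trans (hu.mono (by norm_num))
  have hc : Continuous fun β => rootDiff 0 (u 1 - u β) :=
    (continuous_rootDiff_right 0).comp (continuous_const.sub hu.continuous)
  have h1 : ∫ _ in (-1 : ℝ)..0, √(u 1) ≤ ∫ β in (-1 : ℝ)..0, rootDiff 0 (u 1 - u β) := by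
    refine intervalIntegral.integral_mono_on (by norm_num) (by simp)
      (hc.intervalIntegrable _ _) fun β hβ => ?_
    have := hu.mono hβ.2
    rw [hu.map_zero] at this
    rw [← rootDiff_of_nonneg h0]
    exact monotone_rootDiff 0 (by linarith)
  have h2 : 0 ≤ ∫ β in (0 : ℝ)..1, rootDiff 0 (u 1 - u β) := by
    refine intervalIntegral.integral_nonneg (by norm_num) fun β hβ => ?_
    rw [rootDiff_of_nonneg (sub_nonneg.mpr (hu.mono hβ.2))]
    positivity
  have h3 := intervalIntegral.integral_add_adjacent_intervals
    (hc.intervalIntegrable (μ := volume) (-1) 0) (hc.intervalIntegrable 0 1)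
  rw [intervalIntegral.integral_const, smul_eq_mul] at h1
  unfold drift
  linarith

/-- A nonnegative antitone function with right derivative at most `-√f` and `f 0 ≤ 1`
vanishes at time `2`. -/
lemma eq_zero_of_hasDerivWithinAt_le_neg_sqrt {f d : ℝ → ℝ} (hf : Continuous f)
    (hanti : Antitone f) (hnonneg : ∀ t, 0 ≤ f t) (h0 : f 0 ≤ 1)
    (hderiv : ∀ t, 0 ≤ t → HasDerivWithinAt f (-d t) (Ici t) t) (hd : ∀ t, √(f t) ≤ d t) :
    f 2 = 0 := by
  by_contra hne
  have hpos : 0 < f 2 := lt_of_le_of_ne (hnonneg 2) (Ne.symm hne)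
  have hpos' {t : ℝ} (ht : t ≤ 2) : 0 < f t := hpos.trans_le (hanti ht)
  have key := image_le_of_deriv_right_le_deriv_boundary (f := fun t => √(f t))
    (f' := fun t => -d t / (2 * √(f t))) (B := fun t => 1 - t / 2) (B' := fun _ => -(1 / 2))
    (a := 0) (b := 2) (by fun_prop)
    (fun t ht => (hderiv t ht.1).sqrt (hpos' ht.2.le).ne')
    (by simpa using h0) (by fun_prop)
    (fun t _ => (((hasDerivAt_id t).div_const 2).const_sub 1).hasDerivWithinAt)
    (fun t ht => by
      have : 0 < √(f t) := Real.sqrt_pos.mpr (hpos' ht.2.le)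
      rw [div_le_iff₀ (by positivity)]
      linarith [hd t])
    (x := 2) (by norm_num)
  have : 0 < √(f 2) := Real.sqrt_pos.mpr hpos
  norm_num at key
  linarith

/-- There is a function `Y`, Lipschitz on `[0,∞) × [-1,1]`,
solving the integral equation
`Y(t,α) = α - ∫₀ᵗ ∫_{-1}^1 g (Y(s,α) - Y(s,β)) dβ ds`,
such that `Y(t,·)` is odd and nondecreasing, `t ↦ |Y(t,α)|` is nonincreasing, and
`Y(t,α) = 0` for all `t ≥ 2`. -/
theorem statement18 :
    ∃ Y : ℝ → ℝ → ℝ,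
      (∃ K : NNReal, LipschitzOnWith K (Function.uncurry Y)
        (Ici (0 : ℝ) ×ˢ Icc (-1 : ℝ) 1)) ∧
      (∀ t ∈ Ici (0 : ℝ), ∀ α ∈ Icc (-1 : ℝ) 1,
        Y t α = α - ∫ s in Icc (0 : ℝ) t,
          ∫ β in Icc (-1 : ℝ) 1, gFun (Y s α - Y s β)) ∧
      (∀ t ∈ Ici (0 : ℝ), ∀ α ∈ Icc (-1 : ℝ) 1, Y t (-α) = -(Y t α)) ∧
      (∀ t ∈ Ici (0 : ℝ), MonotoneOn (Y t) (Icc (-1 : ℝ) 1)) ∧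
      (∀ α ∈ Icc (-1 : ℝ) 1, AntitoneOn (fun t => |Y t α|) (Ici (0 : ℝ))) ∧
      (∀ t : ℝ, 2 ≤ t → ∀ α ∈ Icc (-1 : ℝ) 1, Y t α = 0) := by
  obtain ⟨Y, hlip, hprof, hanti, hzero, hstep⟩ := exists_limit_eulerApprox
  have hY : LipschitzWith 7 (Function.uncurry Y) := by
    refine LipschitzWith.of_dist_le_mul fun p q => ?_
    have h1 : |p.1 - q.1| ≤ dist p q := le_max_left _ _
    have h2 : |p.2 - q.2| ≤ dist p q := le_max_right _ _
    have := hlip p.1 q.1 p.2 q.2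
    rw [Real.dist_eq]
    simp only [Function.uncurry, NNReal.coe_ofNat]
    linarith
  have hcont (a : ℝ) : Continuous fun t => Y t a := hY.continuous.comp (Continuous.prodMk_left a)
  have hderiv (a : ℝ) (t : ℝ) (ht : 0 ≤ t) :
      HasDerivWithinAt (fun t => Y t a) (-drift 0 (Y t) (Y t a)) (Ici t) t :=
    hasDerivWithinAt_Ici_of_abs_sub_le fun r hr => hstep t r a ht hr
  have hnonneg (t : ℝ) : 0 ≤ Y t 1 :=
    (hprof t).map_zero.symm.le.trans ((hprof t).mono (by norm_num))
  refine ⟨Y, ⟨7, hY.lipschitzOnWith⟩, fun t ht α hα => ?_, fun t _ α _ => (hprof t).odd α,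
    fun t _ => (hprof t).mono.monotoneOn _, fun α _ => (hanti α).antitoneOn _,
    fun t ht α hα => ?_⟩
  · have hdrift : Continuous fun s => -drift 0 (Y s) (Y s α) := by
      refine (intervalIntegral.continuous_parametric_intervalIntegral_of_continuous' ?_ _ _).neg
      exact (continuous_rootDiff_right 0).comp
        (((hcont α).comp continuous_fst).sub hY.continuous)
    have hftc := intervalIntegral.integral_eq_sub_of_hasDeriv_right_of_le ht
      (hcont α).continuousOn (fun s hs => (hderiv α s hs.1.le).mono Ioi_subset_Ici_self)
      (hdrift.intervalIntegrable 0 t)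
    rw [intervalIntegral.integral_neg, hzero α hα] at hftc
    have hint : ∫ s in Icc (0 : ℝ) t, ∫ β in Icc (-1 : ℝ) 1, gFun (Y s α - Y s β) =
        ∫ s in (0 : ℝ)..t, drift 0 (Y s) (Y s α) := by
      rw [integral_Icc_eq_integral_Ioc, ← intervalIntegral.integral_of_le ht]
      congr 1
      ext s
      rw [integral_Icc_eq_integral_Ioc, ← intervalIntegral.integral_of_le (by norm_num)]
      simp only [gFun_eq_rootDiff, drift]
    rw [hint]
    linarith
  · have h2 : Y 2 1 = 0 := eq_zero_of_hasDerivWithinAt_le_neg_sqrt (hcont 1)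
      (by simpa only [abs_of_nonneg (hnonneg _)] using hanti 1) hnonneg
      (hzero 1 (by norm_num)).le (hderiv 1) fun t => (hprof t).sqrt_le_drift
    have h1 : Y t 1 = 0 := by simpa [h2] using hanti 1 ht
    have hle := (hprof t).mono hα.2
    have hge := (hprof t).mono hα.1
    rw [(hprof t).odd, h1] at hge
    linarith

end
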